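/- arXiv:math/0607518 — 7 statements merged into one kernel-verified Lean document; each statement's English description precedes it below -/
import Mathlib

section
/- Suppose the matrix A satisfies condition (I). Then the set X_{Λ_A} is infinite, and consequently the family of predecessor sets { Γ⁻(x) : x ∈ X_{Λ_A} } is an infinite family of pairwise distinct sets of finite words over Σ. (This is the content of the proof that the topological Markov Dyck shift D_A is not sofic, Proposition 2.1.) -/
open scoped BigOperators

/-- A word over `{1,…,N}` is `Λ_A`-admissible if consecutive letters obey `A`. -/
def MarkovAdm {N : ℕ} (A : Fin N → Fin N → Bool) (w : List (Fin N)) : Prop :=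
  w.Chain' fun i j => A i j = true

/-- The one-sided topological Markov shift space `X_{Λ_A}`. -/
def XMarkov {N : ℕ} (A : Fin N → Fin N → Bool) : Type :=
  {x : ℕ → Fin N // ∀ n, A (x n) (x (n + 1)) = true}

/-- Prepend a symbol to a one-sided sequence. -/
def consSeq {N : ℕ} (i : Fin N) (x : ℕ → Fin N) : ℕ → Fin N
  | 0 => i
  | n + 1 => x n

/-- The partial map `τ_i` (creation: `x ↦ ix` when `A(i,x₁)=1`), i.e. `φ(β_i)`. -/
def tauBeta {N : ℕ} (A : Fin N → Fin N → Bool) (i : Fin N) (x : XMarkov A) :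
    Option (XMarkov A) :=
  if h : A i (x.1 0) = true then
    some ⟨consSeq i x.1, by
      intro n
      cases n with
      | zero => simpa [consSeq] using h
      | succ m => simpa [consSeq] using x.2 m⟩
  else none

/-- The partial map `τ_i⁻¹` (deletes the first symbol when it equals `i`), i.e. `φ(α_i)`. -/
def tauAlpha {N : ℕ} (A : Fin N → Fin N → Bool) (i : Fin N) (x : XMarkov A) :
    Option (XMarkov A) :=
  if x.1 0 = i then some ⟨fun n => x.1 (n + 1), fun n => x.2 (n + 1)⟩ else none

/-- The alphabet `Σ`: `Sum.inl i = α_i`, `Sum.inr i = β_i`. -/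
abbrev DyckSym (N : ℕ) := Fin N ⊕ Fin N

/-- `φ(α_i) = τ_i⁻¹`, `φ(β_i) = τ_i`. -/
def phiMap {N : ℕ} (A : Fin N → Fin N → Bool) :
    DyckSym N → XMarkov A → Option (XMarkov A)
  | Sum.inl i => tauAlpha A i
  | Sum.inr i => tauBeta A i

/-- The composite partial map `φ(γ₁)∘⋯∘φ(γ_n)` (rightmost applied first) applied to `x`. -/
def applyWord {N : ℕ} (A : Fin N → Fin N → Bool) (w : List (DyckSym N))
    (x : XMarkov A) : Option (XMarkov A) :=
  w.foldr (fun γ o => o.bind (phiMap A γ)) (some x)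

/-- A word over `Σ` is `D_A`-admissible if the composite partial map has nonempty domain. -/
def DAdm {N : ℕ} (A : Fin N → Fin N → Bool) (w : List (DyckSym N)) : Prop :=
  ∃ x : XMarkov A, (applyWord A w x).isSome

/-- Cuntz–Krieger condition (I) for the matrix `A`. -/
def CondI {N : ℕ} (A : Fin N → Fin N → Bool) : Prop :=
  ∀ i : Fin N, ∃ μ ν : List (Fin N), 2 ≤ μ.length ∧ μ.length = ν.length ∧
    MarkovAdm A μ ∧ MarkovAdm A ν ∧ μ ≠ ν ∧
    μ.head? = some i ∧ ν.head? = some i ∧ μ.getLast? = ν.getLast?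

/-- The predecessor set `Γ⁻(x)` of `x ∈ X_{Λ_A}` inside `D_A`. -/
def GammaPred {N : ℕ} (A : Fin N → Fin N → Bool) (x : XMarkov A) :
    Set (List (DyckSym N)) :=
  {w | ∀ m : ℕ, 1 ≤ m → DAdm A (w ++ (List.range m).map fun k => Sum.inr (x.1 k))}

/-- The `m`-fold left shift on `XMarkov A`. -/
def shiftSeq {N : ℕ} {A : Fin N → Fin N → Bool} (m : ℕ) (x : XMarkov A) : XMarkov A :=
  ⟨fun n => x.1 (n + m), fun n => by
    have h := x.2 (n + m)
    rwa [show n + m + 1 = n + 1 + m by omega] at h⟩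

theorem applyWord_append {N : ℕ} (A : Fin N → Fin N → Bool) (u v : List (DyckSym N))
    (x : XMarkov A) :
    applyWord A (u ++ v) x = (applyWord A v x).bind (applyWord A u) := by
  induction u with
  | nil => cases h : applyWord A v x <;> simp_all [applyWord]
  | cons a u ih =>
    change (applyWord A (u ++ v) x).bind (phiMap A a) = _
    rw [ih, Option.bind_assoc]
    rfl

theorem tauBeta_shiftSeq {N : ℕ} (A : Fin N → Fin N → Bool) (x : XMarkov A) (m : ℕ) :
    tauBeta A (x.1 m) (shiftSeq (m + 1) x) = some (shiftSeq m x) := by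
  have h : A (x.1 m) ((shiftSeq (m + 1) x).1 0) = true := by
    simpa [shiftSeq] using x.2 m
  rw [tauBeta, dif_pos h]
  congr 1
  apply Subtype.ext
  funext n
  cases n with
  | zero => simp [consSeq, shiftSeq]
  | succ n => exact congrArg x.1 (by omega)

theorem tauAlpha_eq_some_iff {N : ℕ} (A : Fin N → Fin N → Bool) (i : Fin N)
    (x y : XMarkov A) : tauAlpha A i x = some y ↔ x.1 0 = i ∧ shiftSeq 1 x = y := by
  unfold tauAlpha
  split_ifs with h
  · exact ⟨fun e => ⟨h, Option.some.inj e⟩, fun e => congrArg some e.2⟩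
  · simp [h]

theorem consSeq_of_tauBeta_eq_some {N : ℕ} {A : Fin N → Fin N → Bool} {i : Fin N}
    {x y : XMarkov A} (h : tauBeta A i x = some y) : y.1 = consSeq i x.1 := by
  unfold tauBeta at h
  split_ifs at h
  cases h
  rfl

/-- Creating the first `m` symbols of `x` on top of its `m`-fold shift gives back `x`. -/
theorem applyWord_inr_shiftSeq {N : ℕ} (A : Fin N → Fin N → Bool) (x : XMarkov A) (m : ℕ) :
    applyWord A ((List.range m).map fun k => Sum.inr (x.1 k)) (shiftSeq m x) = some x := by
  induction m with
  | zero => rfl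
  | succ m ih =>
    rw [List.range_succ, List.map_append, applyWord_append]
    simpa [applyWord, phiMap, tauBeta_shiftSeq] using ih

/-- Creating the symbols of a word yields a point that starts with that word. -/
theorem apply_eq_of_applyWord_inr {N : ℕ} {A : Fin N → Fin N → Bool} (u : ℕ → Fin N) (m : ℕ)
    (z y : XMarkov A)
    (h : applyWord A ((List.range m).map fun k => Sum.inr (u k)) z = some y) :
    ∀ k < m, y.1 k = u k := by
  induction m generalizing u y with
  | zero => intro k hk; omega
  | succ m ih =>
    rw [List.range_succ_eq_map, List.map_cons, List.map_map] at h
    change (applyWord A ((List.range m).map fun k => Sum.inr (u (k + 1))) z).bind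
      (tauBeta A (u 0)) = some y at h
    obtain ⟨y', hy', hb⟩ := Option.bind_eq_some_iff.1 h
    have hc := consSeq_of_tauBeta_eq_some hb
    intro k hk
    rw [hc]
    cases k with
    | zero => rfl
    | succ k => exact ih (fun k => u (k + 1)) y' hy' k (by omega)

/-- The word annihilating `u₀, …, u_{m-1}` is defined exactly at the points starting with it. -/
theorem applyWord_inl_eq_some_iff {N : ℕ} (A : Fin N → Fin N → Bool) (u : ℕ → Fin N) (m : ℕ)
    (x y : XMarkov A) :
    applyWord A ((List.range m).reverse.map fun k => Sum.inl (u k)) x = some y ↔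
      (∀ k < m, x.1 k = u k) ∧ shiftSeq m x = y := by
  induction m generalizing y with
  | zero =>
    exact ⟨fun e => ⟨by simp, Option.some.inj e⟩, fun e => congrArg some e.2⟩
  | succ m ih =>
    rw [List.range_succ, List.reverse_append, List.map_append]
    change (applyWord A ((List.range m).reverse.map fun k => Sum.inl (u k)) x).bind
      (tauAlpha A (u m)) = some y ↔ _
    have hs : shiftSeq 1 (shiftSeq m x) = shiftSeq (m + 1) x := by
      apply Subtype.ext
      funext n
      exact congrArg x.1 (by omega)
    simp only [Option.bind_eq_some_iff, ih, tauAlpha_eq_some_iff]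
    constructor
    · rintro ⟨_, ⟨h, rfl⟩, h0, h1⟩
      refine ⟨fun k hk => ?_, hs ▸ h1⟩
      rcases Nat.lt_succ_iff_lt_or_eq.1 hk with hk | rfl
      · exact h k hk
      · simpa [shiftSeq] using h0
    · rintro ⟨h, h1⟩
      exact ⟨_, ⟨fun k hk => h k (by omega), rfl⟩, by simpa [shiftSeq] using h m (by omega),
        hs.trans h1⟩

theorem gammaPred_injective {N : ℕ} (A : Fin N → Fin N → Bool) :
    Function.Injective (GammaPred A) := by
  intro x y hxy
  apply Subtype.ext
  funext k
  have hx : ((List.range (k + 1)).reverse.map fun k => Sum.inl (x.1 k)) ∈ GammaPred A x := by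
    intro m _
    refine ⟨shiftSeq m x, ?_⟩
    rw [applyWord_append, applyWord_inr_shiftSeq, Option.bind_some,
      (applyWord_inl_eq_some_iff A x.1 (k + 1) x _).2 ⟨fun _ _ => rfl, rfl⟩]
    rfl
  rw [hxy] at hx
  obtain ⟨z, hz⟩ := hx (k + 1) (by omega)
  obtain ⟨v, hv⟩ := Option.isSome_iff_exists.1 hz
  rw [applyWord_append] at hv
  obtain ⟨t, ht, hv⟩ := Option.bind_eq_some_iff.1 hv
  rw [← ((applyWord_inl_eq_some_iff A _ _ _ _).1 hv).1 k (by omega)]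
  exact apply_eq_of_applyWord_inr y.1 _ z t ht k (by omega)

theorem exists_xMarkov_head {N : ℕ} {A : Fin N → Fin N → Bool}
    (hrow : ∀ i, ∃ j, A i j = true) (i : Fin N) : ∃ x : XMarkov A, x.1 0 = i := by
  choose f hf using hrow
  exact ⟨⟨fun n => f^[n] i, fun n => by
    simpa only [Function.iterate_succ_apply'] using hf (f^[n] i)⟩, rfl⟩

/-- An admissible word ending in `x₀` can be glued to `x` along that symbol. -/
theorem exists_xMarkov_glue {N : ℕ} {A : Fin N → Fin N → Bool} {μ : List (Fin N)}
    (hμ : MarkovAdm A μ) (x : XMarkov A) (hl : μ.getLast? = some (x.1 0)) :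
    ∃ y : XMarkov A, (∀ n, ∀ h : n < μ.length, y.1 n = μ[n]) ∧
      ∀ n, y.1 (μ.length - 1 + n) = x.1 n := by
  have hpos : 0 < μ.length := by
    rcases μ with _ | _ <;> simp at hl ⊢
  have hlast : μ[μ.length - 1] = x.1 0 := by
    rw [List.getLast?_eq_getElem?, List.getElem?_eq_getElem (by omega)] at hl
    exact Option.some.inj hl
  have hchain := List.isChain_iff_getElem.1 hμ
  let y : ℕ → Fin N := fun n => if h : n < μ.length then μ[n] else x.1 (n - (μ.length - 1))
  have hy1 : ∀ n, ∀ h : n < μ.length, y n = μ[n] := fun n h => dif_pos h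
  have hy2 : ∀ n, y (μ.length - 1 + n) = x.1 n := by
    intro n
    rcases n with _ | n
    · rw [hy1 _ (by omega)]
      exact hlast
    · simp only [y]
      rw [dif_neg (by omega)]
      exact congrArg x.1 (by omega)
  refine ⟨⟨y, fun n => ?_⟩, hy1, hy2⟩
  by_cases h : n + 1 < μ.length
  · rw [hy1 n (by omega), hy1 (n + 1) h]
    exact hchain n h
  · obtain ⟨k, rfl⟩ : ∃ k, n = μ.length - 1 + k := ⟨n - (μ.length - 1), by omega⟩
    rw [add_assoc, hy2, hy2]
    exact x.2 k

theorem infinite_xMarkov {N : ℕ} (hN : 0 < N) {A : Fin N → Fin N → Bool}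
    (hrow : ∀ i, ∃ j, A i j = true) (hI : CondI A) : Infinite (XMarkov A) := by
  by_contra hinf
  have : Finite (XMarkov A) := not_infinite_iff_finite.1 hinf
  have : Nonempty (Fin N) := ⟨⟨0, hN⟩⟩
  obtain ⟨i, hi⟩ := Finite.exists_min fun i => Nat.card {x : XMarkov A // x.1 0 = i}
  obtain ⟨μ, ν, hlen, heq, hμ, hν, hne, hμi, hνi, hlast⟩ := hI i
  obtain ⟨j, hj⟩ : ∃ j, μ.getLast? = some j :=
    ⟨_, List.getLast?_eq_some_getLast (by rintro rfl; simp at hlen)⟩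
  have key : ∀ p : Bool × {x : XMarkov A // x.1 0 = j}, ∃ y : {x : XMarkov A // x.1 0 = i},
      (∀ n, n < μ.length → (if p.1 then μ else ν)[n]? = some (y.1.1 n)) ∧
        ∀ n, y.1.1 (μ.length - 1 + n) = p.2.1.1 n := by
    rintro ⟨b, x, hx⟩
    have glue : ∀ κ : List (Fin N), MarkovAdm A κ → κ.length = μ.length → κ.head? = some i →
        κ.getLast? = some j → ∃ y : {x : XMarkov A // x.1 0 = i},
          (∀ n, n < μ.length → κ[n]? = some (y.1.1 n)) ∧
            ∀ n, y.1.1 (μ.length - 1 + n) = x.1 n := by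
      intro κ hκ hl hh hg
      obtain ⟨y, hy1, hy2⟩ := exists_xMarkov_glue hκ x (hx ▸ hg)
      have hy3 : ∀ n, n < μ.length → κ[n]? = some (y.1 n) := fun n hn => by
        rw [hy1 n (by omega), List.getElem?_eq_getElem]
      refine ⟨⟨y, ?_⟩, hy3, hl ▸ hy2⟩
      have h0 := hy3 0 (by omega)
      rw [← List.head?_eq_getElem?, hh] at h0
      exact (Option.some.inj h0).symm
    cases b
    · exact glue ν hν heq.symm hνi (hlast ▸ hj)
    · exact glue μ hμ rfl hμi hj
  choose f hf1 hf2 using key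
  have hinj : Function.Injective f := by
    intro p q hpq
    have hb : p.1 = q.1 := by
      by_contra hb
      have hext : (if p.1 then μ else ν) = if q.1 then μ else ν := by
        apply List.ext_getElem?
        intro n
        by_cases hn : n < μ.length
        · rw [hf1 p n hn, hf1 q n hn, hpq]
        · rw [List.getElem?_eq_none, List.getElem?_eq_none] <;> split_ifs <;> omega
      rcases hp : p.1 <;> rcases hq : q.1 <;> simp_all
    refine Prod.ext hb (Subtype.ext (Subtype.ext (funext fun n => ?_)))
    rw [← hf2 p n, ← hf2 q n, hpq]
  have hcard := Nat.card_le_card_of_injective f hinj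
  rw [Nat.card_prod, Nat.card_eq_fintype_card, Fintype.card_bool] at hcard
  obtain ⟨x, hx⟩ := exists_xMarkov_head hrow j
  have : Nonempty {x : XMarkov A // x.1 0 = j} := ⟨⟨x, hx⟩⟩
  have hpos : 0 < Nat.card {x : XMarkov A // x.1 0 = j} := Nat.card_pos
  have := hi j
  omega

/-- Proposition 2.1: if `A` satisfies condition (I) then
`X_{Λ_A}` is infinite and the predecessor sets `Γ⁻(x)`, `x ∈ X_{Λ_A}`, form an
infinite family of pairwise distinct sets of finite words over `Σ`. -/
theorem stmt3 {N : ℕ} (hN : 2 ≤ N) (A : Fin N → Fin N → Bool)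
    (hrow : ∀ i, ∃ j, A i j = true) (hcol : ∀ j, ∃ i, A i j = true)
    (hI : CondI A) :
    Infinite (XMarkov A) ∧ Function.Injective (GammaPred A) ∧
      (Set.range (GammaPred A)).Infinite := by
  have hinf := infinite_xMarkov (by omega) hrow hI
  exact ⟨hinf, gammaPred_injective A, Set.infinite_range_of_injective (gammaPred_injective A)⟩
end

section
/- (Proposition 2.5 (i)) Suppose A satisfies condition (I). Then the λ-graph system L^{Ch(D_A)} satisfies λ-condition (I): for every l ≥ 1 and every vertex w ∈ V_l = B_l(Λ_A) there exist m ≥ 1, a vertex z ∈ V_{l+m}, and two paths of length m from w to z whose label sequences are distinct; moreover both paths can be chosen with all labels in Σ⁺ = {β_1,…,β_N}. -/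
open scoped BigOperators

/-- Labeled edges of the Cantor horizon λ-graph system `L^{Ch(D_A)}`: vertices at
level `l` are the `Λ_A`-admissible words of length `l` (`[]` is the level-0 vertex `∅`),
and `LEdge A u v γ` says there is an edge labeled `γ` from `u` to `v`.
An `α_j`-edge goes from `μ₁⋯μ_l` to `μ₀μ₁⋯μ_l` exactly when `μ₀ = j`; a `β_j`-edge
goes from `jν₁⋯ν_{l-1}` to `ν₁⋯ν_{l+1}` (for `l = 0,1` from `∅` to `(i)` with
`A(j,i) = 1`, resp. from `(j)` to `ν₁ν₂` with `A(j,ν₁) = 1`). -/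
def LEdge {N : ℕ} (A : Fin N → Fin N → Bool) (u v : List (Fin N)) :
    DyckSym N → Prop
  | Sum.inl j => MarkovAdm A u ∧ MarkovAdm A v ∧ v = j :: u
  | Sum.inr j =>
      MarkovAdm A u ∧ MarkovAdm A v ∧ v.length = u.length + 1 ∧
      (∀ h, u.head? = some h → h = j) ∧
      u.tail = v.take (u.length - 1) ∧
      ∃ h, v.head? = some h ∧ A j h = true

/-- `RPathTo A w v` : the *reversed* label list `w` (last edge first) is the label
sequence of a path in `L^{Ch(D_A)}` ending at the vertex `v`. -/
def RPathTo {N : ℕ} (A : Fin N → Fin N → Bool) :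
    List (DyckSym N) → List (Fin N) → Prop
  | [], v => MarkovAdm A v
  | γ :: w, v => ∃ u, LEdge A u v γ ∧ RPathTo A w u

/-- `RPathFromTo A w u v` : the *reversed* label list `w` (last edge first) is the
label sequence of a path in `L^{Ch(D_A)}` from the vertex `u` to the vertex `v`. -/
def RPathFromTo {N : ℕ} (A : Fin N → Fin N → Bool) :
    List (DyckSym N) → List (Fin N) → List (Fin N) → Prop
  | [], u, v => MarkovAdm A u ∧ u = v
  | γ :: w, u, v => ∃ z, LEdge A z v γ ∧ RPathFromTo A w u z

theorem exists_markovAdm_cons {N : ℕ} {A : Fin N → Fin N → Bool}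
    (hrow : ∀ i, ∃ j, A i j = true) (n : ℕ) (i : Fin N) :
    ∃ t : List (Fin N), t.length = n ∧ MarkovAdm A (i :: t) := by
  induction n generalizing i with
  | zero => exact ⟨[], rfl, List.isChain_singleton i⟩
  | succ n ih =>
    obtain ⟨j, hj⟩ := hrow i
    obtain ⟨t, ht, hadm⟩ := ih j
    exact ⟨j :: t, by simp [ht], List.isChain_cons_cons.2 ⟨hj, hadm⟩⟩

theorem MarkovAdm.append_overlap {N : ℕ} {A : Fin N → Fin N → Bool} {a b : List (Fin N)}
    {i : Fin N} (ha : MarkovAdm A (a ++ [i])) (hb : MarkovAdm A (i :: b)) :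
    MarkovAdm A (a ++ [i] ++ b) :=
  List.IsChain.append_overlap ha (l₂ := [i]) hb (List.cons_ne_nil _ _)

/-- An admissible word `q.reverse ++ s` with `s` long enough yields a path labeled by the
`β`-symbols of `q.reverse`, which deletes one letter and appends two at each step. -/
theorem rPathFromTo_map_inr {N : ℕ} {A : Fin N → Fin N → Bool} {l : ℕ} (hl : 1 ≤ l)
    (q s : List (Fin N)) (hs : l + q.length ≤ s.length) (hadm : MarkovAdm A (q.reverse ++ s)) :
    RPathFromTo A (q.map Sum.inr) ((q.reverse ++ s).take l) (s.take (l + q.length)) := by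
  induction q generalizing s with
  | nil => exact ⟨List.IsChain.take hadm l, by simp⟩
  | cons a q ih =>
    rw [List.reverse_cons, List.append_assoc, List.singleton_append] at hadm ⊢
    rw [List.length_cons] at hs
    have has : MarkovAdm A (a :: s) := List.IsChain.right_of_append hadm
    refine ⟨(a :: s).take (l + q.length), ?_, ih (a :: s) (by simp; omega) hadm⟩
    obtain ⟨k, hk⟩ : ∃ k, l + q.length = k + 1 := ⟨l + q.length - 1, by omega⟩
    rw [List.length_cons, ← add_assoc, hk]
    refine ⟨List.IsChain.take has _, List.IsChain.take has.tail _, ?_, ?_, ?_, ?_⟩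
    · simp; omega
    · simp
    · simp [List.take_take]; omega
    · cases s with
      | nil => simp at hs
      | cons b s => exact ⟨b, by simp, (List.isChain_cons_cons.1 has).1⟩

/-- Proposition 2.5 (i): if `A` satisfies condition (I) then
`L^{Ch(D_A)}` satisfies λ-condition (I): from every vertex `w ∈ V_l` (`l ≥ 1`)
there are two paths of the same length `m ≥ 1`, with distinct label sequences,
terminating at a common vertex `z`, and with all labels in `Σ⁺ = {β_j}`. -/
theorem stmt8 {N : ℕ} (hN : 2 ≤ N) (A : Fin N → Fin N → Bool)
    (hrow : ∀ i, ∃ j, A i j = true) (hcol : ∀ j, ∃ i, A i j = true)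
    (hI : CondI A) (l : ℕ) (hl : 1 ≤ l) (w : List (Fin N)) (hwl : w.length = l)
    (hadm : MarkovAdm A w) :
    ∃ m : ℕ, 1 ≤ m ∧ ∃ z : List (Fin N), ∃ p q : List (DyckSym N),
      p.length = m ∧ q.length = m ∧ p ≠ q ∧
      (∀ γ ∈ p, ∃ j : Fin N, γ = Sum.inr j) ∧
      (∀ γ ∈ q, ∃ j : Fin N, γ = Sum.inr j) ∧
      RPathFromTo A p.reverse w z ∧ RPathFromTo A q.reverse w z := by
  have hw : w ≠ [] := by rintro rfl; simp at hwl; omega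
  obtain ⟨w₀, i, rfl⟩ := (List.eq_nil_or_concat' w).resolve_left hw
  obtain ⟨μ, ν, -, hlen, hμ, hν, hne, hμi, hνi, hlast⟩ := hI i
  obtain ⟨μ', rfl⟩ := List.head?_eq_some_iff.1 hμi
  obtain ⟨ν', rfl⟩ := List.head?_eq_some_iff.1 hνi
  obtain ⟨e, he⟩ : ∃ e, (i :: μ').getLast? = some e := ⟨_, List.getLast?_eq_some_getLast (by simp)⟩
  obtain ⟨t, ht, hadmt⟩ := exists_markovAdm_cons hrow (l + (l + μ'.length)) e
  have hpath : ∀ κ : List (Fin N), κ.length = μ'.length → MarkovAdm A (i :: κ) →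
      (i :: κ).getLast? = some e →
      RPathFromTo A ((w₀ ++ [i] ++ κ).map Sum.inr).reverse (w₀ ++ [i]) t := by
    intro κ hκ hadmκ hκe
    have hκt : MarkovAdm A ((i :: κ) ++ t) := by
      obtain ⟨b, hb⟩ := List.getLast?_eq_some_iff.1 hκe
      rw [hb] at hadmκ ⊢
      exact hadmκ.append_overlap hadmt
    have hall : MarkovAdm A (w₀ ++ [i] ++ (κ ++ t)) := hadm.append_overlap hκt
    have h := rPathFromTo_map_inr hl (w₀ ++ [i] ++ κ).reverse t
      (by simp only [List.length_reverse, List.length_append] at hwl ⊢; omega)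
      (by rwa [List.reverse_reverse, List.append_assoc])
    rwa [List.reverse_reverse, List.append_assoc _ κ t, List.take_left' hwl,
      List.take_of_length_le, List.map_reverse] at h
    simp only [List.length_reverse, List.length_append] at hwl ⊢; omega
  have hlen' : ν'.length = μ'.length := by simpa using hlen.symm
  refine ⟨l + μ'.length, by omega, t, (w₀ ++ [i] ++ μ').map Sum.inr,
    (w₀ ++ [i] ++ ν').map Sum.inr, ?_, ?_, ?_, ?_, ?_, hpath μ' rfl hμ he,
    hpath ν' hlen' hν (hlast ▸ he)⟩
  · rw [List.length_map, List.length_append, hwl]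
  · rw [List.length_map, List.length_append, hwl, hlen']
  · intro h
    exact hne (congrArg _ (List.append_cancel_left (List.map_injective_iff.2 Sum.inr_injective h)))
  all_goals
    intro γ hγ
    obtain ⟨j, -, rfl⟩ := List.mem_map.1 hγ
    exact ⟨j, rfl⟩
end

section
/- (Identity (3.5)) Under the relations (1.1)–(1.4), for each i = 1,…,N one has S_i* S_i = Σ_{j=1}^N A(j,i) S_j S_j* S_i* S_i S_j S_j* + T_i T_i*. -/
open scoped BigOperators

/-- `Eproj S [μ₁,…,μ_k] = S_{μ₁}*⋯S_{μ_k}* S_{μ_k}⋯S_{μ₁}` (and `Eproj S [] = 1`). -/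
def Eproj {N : ℕ} {B : Type*} [Ring B] [StarRing B] (S : Fin N → B) :
    List (Fin N) → B
  | [] => 1
  | i :: w => star (S i) * Eproj S w * S i

/-- identity (3.5): under the relations (1.1)–(1.4),
`S_i* S_i = Σ_j A(j,i) S_j S_j* S_i* S_i S_j S_j* + T_i T_i*`. -/
theorem stmt9 {N : ℕ} (hN : 2 ≤ N) (A : Fin N → Fin N → Bool)
    (hrow : ∀ i, ∃ j, A i j = true) (hcol : ∀ j, ∃ i, A i j = true)
    {B : Type*} [CStarAlgebra B] (S T : Fin N → B)
    (hSpi : ∀ i, S i * star (S i) * S i = S i)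
    (hTpi : ∀ i, T i * star (T i) * T i = T i)
    (h11 : ∑ j, (S j * star (S j) + T j * star (T j)) = 1)
    (h12 : ∑ j, star (S j) * S j = 1)
    (h13 : ∀ i, star (T i) * T i = ∑ j, if A i j then star (S j) * S j else 0)
    (h14 : ∀ (i : Fin N) (w : List (Fin N)), w ≠ [] →
      Eproj S (i :: w) =
        (∑ j, if A j i then
          S j * star (S j) * Eproj S (i :: w) * (S j * star (S j)) else 0)
        + T i * Eproj S w * star (T i))
    (i : Fin N) :
    star (S i) * S i =
      (∑ j, if A j i then
        S j * star (S j) * (star (S i) * S i) * (S j * star (S j)) else 0)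
      + T i * star (T i) := by
  have hE : ∑ k, Eproj S [k] = 1 := by simpa [Eproj] using h12
  have hsum : ∑ k, Eproj S [i, k] = star (S i) * S i := by
    change ∑ k, star (S i) * Eproj S [k] * S i = _
    rw [← Finset.sum_mul, ← Finset.mul_sum, hE, mul_one]
  have h := Finset.sum_congr (rfl : (Finset.univ : Finset (Fin N)) = Finset.univ)
    fun k _ => h14 i [k] (by simp)
  rw [Finset.sum_add_distrib, hsum, Finset.sum_comm, ← Finset.sum_mul, ← Finset.mul_sum, hE,
    mul_one] at h
  refine h.trans ?_
  congr 1
  refine Finset.sum_congr rfl fun j _ => ?_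
  split_ifs
  · rw [← Finset.sum_mul, ← Finset.mul_sum, hsum]
  · simp
end

section
/- (Lemma 3.4 (i)) Under the relations (1.1)–(1.4), for all i, j ∈ {1,…,N}: T_i* S_j* S_j T_i = T_i* T_i if i = j, and T_i* S_j* S_j T_i = 0 if i ≠ j. -/
open scoped BigOperators

section Orthogonality

attribute [local instance] CStarAlgebra.spectralOrder CStarAlgebra.spectralOrderedRing

/-- Projections in a C*-algebra which sum to `1` are mutually orthogonal. -/
theorem IsStarProjection.mul_eq_zero_of_sum_eq_one {ι B : Type*} [Fintype ι] [CStarAlgebra B]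
    {p : ι → B} (hp : ∀ a, IsStarProjection (p a)) (hsum : ∑ a, p a = 1) {a b : ι}
    (hab : a ≠ b) : p a * p b = 0 := by
  classical
  have key : ∀ c, star (p c * p b) * (p c * p b) = p b * p c * p b := fun c => by
    rw [star_mul, (hp c).isSelfAdjoint.star_eq, (hp b).isSelfAdjoint.star_eq, mul_assoc,
      ← mul_assoc (p c), (hp c).isIdempotentElem.eq, mul_assoc]
  have htotal : ∑ c, star (p c * p b) * (p c * p b) = p b := by
    simp only [key]
    rw [← Finset.sum_mul, ← Finset.mul_sum, hsum, mul_one, (hp b).isIdempotentElem.eq]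
  have hzero : ∑ c ∈ Finset.univ.erase b, star (p c * p b) * (p c * p b) = 0 := by
    rw [← Finset.add_sum_erase _ _ (Finset.mem_univ b), key b, (hp b).isIdempotentElem.eq,
      (hp b).isIdempotentElem.eq] at htotal
    simpa using htotal
  have hterm := (Finset.sum_eq_zero_iff_of_nonneg fun c _ => star_mul_self_nonneg _).1 hzero a
    (Finset.mem_erase.2 ⟨hab, Finset.mem_univ a⟩)
  exact CStarRing.star_mul_self_eq_zero_iff _ |>.1 hterm

end Orthogonality

theorem isStarProjection_mul_star_self {B : Type*} [Ring B] [StarRing B] {v : B}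
    (hv : v * star v * v = v) : IsStarProjection (v * star v) :=
  ⟨by rw [IsIdempotentElem, ← mul_assoc, hv], .mul_star_self v⟩

/-- Lemma 3.4 (i): under the relations (1.1)–(1.4),
`T_i* S_j* S_j T_i = T_i* T_i` if `i = j` and `= 0` if `i ≠ j`. -/
theorem stmt10 {N : ℕ} (hN : 2 ≤ N) (A : Fin N → Fin N → Bool)
    (hrow : ∀ i, ∃ j, A i j = true) (hcol : ∀ j, ∃ i, A i j = true)
    {B : Type*} [CStarAlgebra B] (S T : Fin N → B)
    (hSpi : ∀ i, S i * star (S i) * S i = S i)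
    (hTpi : ∀ i, T i * star (T i) * T i = T i)
    (h11 : ∑ j, (S j * star (S j) + T j * star (T j)) = 1)
    (h12 : ∑ j, star (S j) * S j = 1)
    (h13 : ∀ i, star (T i) * T i = ∑ j, if A i j then star (S j) * S j else 0)
    (h14 : ∀ (i : Fin N) (w : List (Fin N)), w ≠ [] →
      Eproj S (i :: w) =
        (∑ j, if A j i then
          S j * star (S j) * Eproj S (i :: w) * (S j * star (S j)) else 0)
        + T i * Eproj S w * star (T i)) :
    (∀ i : Fin N, star (T i) * (star (S i) * S i) * T i = star (T i) * T i) ∧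
    (∀ i j : Fin N, i ≠ j → star (T i) * (star (S j) * S j) * T i = 0) := by
  let p : Fin N ⊕ Fin N → B := Sum.elim (fun j => S j * star (S j)) (fun j => T j * star (T j))
  have hp : ∀ a, IsStarProjection (p a) := by
    rintro (j | j)
    · exact isStarProjection_mul_star_self (hSpi j)
    · exact isStarProjection_mul_star_self (hTpi j)
  have hsum : ∑ a, p a = 1 := by
    rw [Fintype.sum_sum_type, ← h11, Finset.sum_add_distrib]
    rfl
  have hST (j i : Fin N) : S j * star (S j) * T i = 0 := by
    have h : S j * star (S j) * (T i * star (T i)) = 0 :=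
      IsStarProjection.mul_eq_zero_of_sum_eq_one hp hsum (a := .inl j) (b := .inr i) (by simp)
    rw [← hTpi i, ← mul_assoc, h, zero_mul]
  have hTT (j i : Fin N) (hij : i ≠ j) : T j * star (T j) * T i = 0 := by
    have h : T j * star (T j) * (T i * star (T i)) = 0 :=
      IsStarProjection.mul_eq_zero_of_sum_eq_one hp hsum (a := .inr j) (b := .inr i)
        (by simpa using hij.symm)
    rw [← hTpi i, ← mul_assoc, h, zero_mul]
  have hEsum (i : Fin N) : ∑ k, Eproj S [i, k] = star (S i) * S i := by
    simp only [Eproj, mul_one]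
    rw [← Finset.sum_mul, ← Finset.mul_sum, h12, mul_one]
  have hE (j i : Fin N) : star (S j) * S j * T i = T j * star (T j) * T i := by
    have hterm (k : Fin N) :
        Eproj S [j, k] * T i = T j * (star (S k) * S k) * star (T j) * T i := by
      rw [h14 j [k] (by simp), add_mul, Finset.sum_mul, Finset.sum_eq_zero, zero_add]
      · simp only [Eproj, mul_one]
      · intro l _
        split_ifs
        · rw [mul_assoc, hST, mul_zero]
        · rw [zero_mul]
    rw [← hEsum, Finset.sum_mul, Finset.sum_congr rfl fun k _ => hterm k, ← Finset.sum_mul,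
      ← Finset.sum_mul, ← Finset.mul_sum, h12, mul_one]
  refine ⟨fun i => ?_, fun i j hij => ?_⟩
  · rw [mul_assoc, hE, hTpi]
  · rw [mul_assoc, hE, hTT j i hij, mul_zero]
end

section
/- (Lemma 3.4 (ii)) Under the relations (1.1)–(1.4), for every Λ_A-admissible word μ₁⋯μ_l with l ≥ 2 and every i ∈ {1,…,N}: T_i* E_{μ₁⋯μ_l} T_i = A(i,μ₂) E_{μ₂⋯μ_l} if i = μ₁ (and since μ₁μ₂ is admissible this equals E_{μ₂⋯μ_l}), while T_i* E_{μ₁⋯μ_l} T_i = 0 if i ≠ μ₁. -/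
open scoped BigOperators

/-- In a C⋆-algebra, projections summing to `1` are mutually orthogonal. -/
theorem mul_eq_zero_of_sum_isStarProjection_eq_one {B ι : Type*} [CStarAlgebra B] [Fintype ι]
    {p : ι → B} (hp : ∀ i, IsStarProjection (p i)) (hsum : ∑ i, p i = 1)
    {i j : ι} (hij : i ≠ j) : p i * p j = 0 := by
  classical
  let _ := CStarAlgebra.spectralOrder B
  have := CStarAlgebra.spectralOrderedRing B
  have hsa (k : ι) : star (p k) = p k := (hp k).isSelfAdjoint
  have hid (k : ι) : p k * p k = p k := (hp k).isIdempotentElem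
  have hsq (k : ι) : star (p k * p j) * (p k * p j) = p j * p k * p j := by
    rw [star_mul, hsa, hsa, mul_assoc, ← mul_assoc (p k), hid, ← mul_assoc]
  have htotal : ∑ k, p j * p k * p j = p j := by
    rw [← Finset.sum_mul, ← Finset.mul_sum, hsum, mul_one, hid]
  have hzero : ∑ k ∈ Finset.univ.erase j, star (p k * p j) * (p k * p j) = 0 := by
    simp_rw [hsq]
    rw [← Finset.add_sum_erase _ _ (Finset.mem_univ j), hid, hid] at htotal
    exact left_eq_add.mp htotal.symm
  rw [Finset.sum_eq_zero_iff_of_nonneg fun k _ => star_mul_self_nonneg _] at hzero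
  exact CStarRing.star_mul_self_eq_zero_iff _ |>.mp
    (hzero i (Finset.mem_erase.mpr ⟨hij, Finset.mem_univ i⟩))

section PartialIsometry

variable {B : Type*} [Ring B] [StarRing B]

theorem isStarProjection_mul_star {a : B} (ha : a * star a * a = a) :
    IsStarProjection (a * star a) :=
  ⟨by rw [IsIdempotentElem, ← mul_assoc, ha], .mul_star_self a⟩

theorem isStarProjection_star_mul {a : B} (ha : a * star a * a = a) :
    IsStarProjection (star a * a) :=
  ⟨by rw [IsIdempotentElem, mul_assoc, ← mul_assoc a, ha], .star_mul_self a⟩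

theorem star_eq_star_mul_mul_star {a : B} (ha : a * star a * a = a) :
    star a = star a * (a * star a) := by
  simpa [mul_assoc] using (congrArg star ha).symm

theorem star_mul_eq_zero_of_range_orthogonal {a b : B} (ha : a * star a * a = a)
    (hb : b * star b * b = b) (h : a * star a * (b * star b) = 0) : star a * b = 0 := by
  rw [star_eq_star_mul_mul_star ha, ← hb, mul_assoc, ← mul_assoc (a * star a), h, zero_mul,
    mul_zero]

theorem mul_star_eq_zero_of_source_orthogonal {a b : B} (ha : a * star a * a = a)
    (h : star a * a * (star b * b) = 0) : a * (star b * b) = 0 := by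
  rw [← ha, mul_assoc a, mul_assoc a, h, mul_zero]

end PartialIsometry

/-- Lemma 3.4 (ii): under the relations (1.1)–(1.4), for a
`Λ_A`-admissible word `μ₁μ₂⋯μ_l` (`l ≥ 2`):
`T_{μ₁}* E_{μ₁⋯μ_l} T_{μ₁} = A(μ₁,μ₂) E_{μ₂⋯μ_l} = E_{μ₂⋯μ_l}`, and
`T_i* E_{μ₁⋯μ_l} T_i = 0` for `i ≠ μ₁`. -/
theorem stmt11 {N : ℕ} (hN : 2 ≤ N) (A : Fin N → Fin N → Bool)
    (hrow : ∀ i, ∃ j, A i j = true) (hcol : ∀ j, ∃ i, A i j = true)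
    {B : Type*} [CStarAlgebra B] (S T : Fin N → B)
    (hSpi : ∀ i, S i * star (S i) * S i = S i)
    (hTpi : ∀ i, T i * star (T i) * T i = T i)
    (h11 : ∑ j, (S j * star (S j) + T j * star (T j)) = 1)
    (h12 : ∑ j, star (S j) * S j = 1)
    (h13 : ∀ i, star (T i) * T i = ∑ j, if A i j then star (S j) * S j else 0)
    (h14 : ∀ (i : Fin N) (w : List (Fin N)), w ≠ [] →
      Eproj S (i :: w) =
        (∑ j, if A j i then
          S j * star (S j) * Eproj S (i :: w) * (S j * star (S j)) else 0)
        + T i * Eproj S w * star (T i))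
    (μ₁ μ₂ : Fin N) (w : List (Fin N)) (hadm : MarkovAdm A (μ₁ :: μ₂ :: w)) :
    star (T μ₁) * Eproj S (μ₁ :: μ₂ :: w) * T μ₁ =
        (if A μ₁ μ₂ then Eproj S (μ₂ :: w) else 0) ∧
    star (T μ₁) * Eproj S (μ₁ :: μ₂ :: w) * T μ₁ = Eproj S (μ₂ :: w) ∧
    (∀ i : Fin N, i ≠ μ₁ → star (T i) * Eproj S (μ₁ :: μ₂ :: w) * T i = 0) := by
  have hrange (k : Fin N ⊕ Fin N) :
      Sum.elim S T k * star (Sum.elim S T k) * Sum.elim S T k = Sum.elim S T k := by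
    cases k with
    | inl j => exact hSpi j
    | inr j => exact hTpi j
  have hrange_sum : ∑ k, Sum.elim S T k * star (Sum.elim S T k) = 1 := by
    rw [Fintype.sum_sum_type, ← h11, Finset.sum_add_distrib]
    rfl
  have horth {k l : Fin N ⊕ Fin N} (hkl : k ≠ l) :
      star (Sum.elim S T k) * Sum.elim S T l = 0 :=
    star_mul_eq_zero_of_range_orthogonal (hrange k) (hrange l)
      (mul_eq_zero_of_sum_isStarProjection_eq_one
        (fun m => isStarProjection_mul_star (hrange m)) hrange_sum hkl)
  have hTS (i j : Fin N) : star (T i) * S j = 0 :=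
    horth (k := .inr i) (l := .inl j) (by simp)
  have hTT (i j : Fin N) (hij : i ≠ j) : star (T i) * T j = 0 :=
    horth (k := .inr i) (l := .inr j) (by simpa using hij)
  have hcompress (i : Fin N) : star (T i) * Eproj S (μ₁ :: μ₂ :: w) * T i =
      star (T i) * T μ₁ * Eproj S (μ₂ :: w) * (star (T μ₁) * T i) := by
    have hS : star (T i) * (∑ j, if A j μ₁ then S j * star (S j) *
        Eproj S (μ₁ :: μ₂ :: w) * (S j * star (S j)) else 0) = 0 := by
      rw [Finset.mul_sum]
      refine Finset.sum_eq_zero fun j _ => ?_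
      split_ifs
      · simp only [← mul_assoc, hTS, zero_mul]
      · exact mul_zero _
    rw [h14 μ₁ (μ₂ :: w) (List.cons_ne_nil _ _), mul_add, hS, zero_add]
    simp only [mul_assoc]
  have hA : A μ₁ μ₂ = true := (List.isChain_cons_cons.mp hadm).1
  have hSQ : S μ₂ * (star (T μ₁) * T μ₁) = S μ₂ := by
    rw [h13, Finset.mul_sum, Finset.sum_eq_single μ₂]
    · rw [if_pos hA, ← mul_assoc, hSpi]
    · intro j _ hj
      split_ifs
      · exact mul_star_eq_zero_of_source_orthogonal (hSpi μ₂)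
          (mul_eq_zero_of_sum_isStarProjection_eq_one
            (fun m => isStarProjection_star_mul (hSpi m)) h12 hj.symm)
      · exact mul_zero _
    · simp
  have hQS : star (T μ₁) * T μ₁ * star (S μ₂) = star (S μ₂) := by
    simpa [mul_assoc] using congrArg star hSQ
  have hmain : star (T μ₁) * Eproj S (μ₁ :: μ₂ :: w) * T μ₁ = Eproj S (μ₂ :: w) := by
    rw [hcompress, Eproj, mul_assoc, mul_assoc _ (S μ₂), hSQ, ← mul_assoc, ← mul_assoc, hQS]
  refine ⟨by rw [if_pos hA, hmain], hmain, fun i hi => ?_⟩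
  rw [hcompress, hTT i μ₁ hi, zero_mul, zero_mul]
end

section
/- (Projection structure, from Proposition 3.7) Under the relations (1.1)–(1.4): (a) for every Λ_A-admissible word μ = μ₁⋯μ_l, E_μ is a projection (self-adjoint idempotent); (b) for distinct Λ_A-admissible words μ ≠ ν of the same length l, E_μ E_ν = 0; (c) for every Λ_A-admissible word μ₁⋯μ_l one has the refinement identity E_{μ₁⋯μ_l} = Σ_{h : A(μ_l,h)=1} E_{μ₁⋯μ_l h}, where μ₁⋯μ_l h denotes the word with h appended. -/
open scoped BigOperators

/-- Projections of a C⋆-algebra with sum `1` are mutually orthogonal. -/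
theorem mul_eq_zero_of_sum_projections_eq_one {ι B : Type*} [Fintype ι] [CStarAlgebra B]
    (p : ι → B) (hsa : ∀ i, star (p i) = p i) (hid : ∀ i, p i * p i = p i)
    (hsum : ∑ i, p i = 1) {i j : ι} (hij : i ≠ j) : p i * p j = 0 := by
  classical
  let _ : PartialOrder B := CStarAlgebra.spectralOrder B
  have : StarOrderedRing B := CStarAlgebra.spectralOrderedRing B
  have h1 : ∑ k, p j * p k * p j = p j := by
    rw [← Finset.sum_mul, ← Finset.mul_sum, hsum, mul_one, hid]
  rw [← Finset.add_sum_erase _ _ (Finset.mem_univ j), hid, hid, add_eq_left] at h1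
  have h2 : ∀ k, p j * p k * p j = star (p k * p j) * (p k * p j) := fun k => by
    rw [star_mul, hsa, hsa, mul_assoc, mul_assoc, ← mul_assoc (p k) (p k), hid]
  have h3 := (Finset.sum_eq_zero_iff_of_nonneg (fun k _ => by
    rw [h2]; exact star_mul_self_nonneg _)).1 h1 i (by simp [hij])
  rw [h2] at h3
  exact CStarRing.star_mul_self_eq_zero_iff _ |>.1 h3

theorem star_Eproj {N : ℕ} {B : Type*} [Ring B] [StarRing B] (S : Fin N → B)
    (w : List (Fin N)) : star (Eproj S w) = Eproj S w := by
  induction w with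
  | nil => simp [Eproj]
  | cons i w ih => simp [Eproj, ih, mul_assoc]

theorem sum_Eproj_append {N : ℕ} {B : Type*} [Ring B] [StarRing B] (S : Fin N → B)
    (h : ∑ j, star (S j) * S j = 1) (w : List (Fin N)) :
    ∑ j, Eproj S (w ++ [j]) = Eproj S w := by
  induction w with
  | nil => simpa [Eproj] using h
  | cons i w ih => simp only [List.cons_append, Eproj, ← Finset.sum_mul, ← Finset.mul_sum, ih]

/-- If `x` is block diagonal up to a corner `t * y * star t` orthogonal to all blocks,
left multiplication by the block projection `p k` picks out the `k`-th block. -/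
theorem mul_eq_block {ι B : Type*} [Fintype ι] [DecidableEq ι] [Ring B] [StarRing B]
    (p : ι → B) (c : ι → Bool) (x y t : B)
    (hid : ∀ i, p i * p i = p i) (horth : ∀ i j, i ≠ j → p i * p j = 0)
    (ht : ∀ i, p i * t = 0)
    (hx : x = (∑ j, if c j then p j * x * p j else 0) + t * y * star t) (k : ι) :
    p k * x = if c k then p k * x * p k else 0 := by
  conv_lhs => rw [hx]
  rw [mul_add, mul_assoc t, ← mul_assoc (p k) t, ht, zero_mul, add_zero, Finset.mul_sum,
    Finset.sum_eq_single k]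
  · split_ifs
    · rw [mul_assoc (p k) x, ← mul_assoc (p k) (p k), hid]
    · simp
  · intro j _ hj
    split_ifs
    · rw [mul_assoc (p j) x, ← mul_assoc (p k) (p j), horth k j hj.symm, zero_mul]
    · simp
  · simp

/-- A projection with `p * x = p * x * p` commutes with `x`, when `x` is self-adjoint. -/
theorem commute_of_mul_eq_block {B : Type*} [Ring B] [StarRing B] {p x : B} (c : Bool)
    (hp : star p = p) (hx : star x = x) (h : p * x = if c then p * x * p else 0) :
    p * x = x * p := by
  have h2 := congrArg star h
  rw [star_mul, hp, hx] at h2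
  cases c
  · simpa using h.trans (by simpa using h2.symm)
  · simp only [if_true, star_mul, hp, hx, ← mul_assoc] at h h2
    rw [h, h2]

theorem Eproj_mul_self {N : ℕ} {B : Type*} [Ring B] [StarRing B] (S : Fin N → B)
    (hS : ∀ i, S i * star (S i) * S i = S i)
    (hcomm : ∀ k w, S k * star (S k) * Eproj S w = Eproj S w * (S k * star (S k)))
    (w : List (Fin N)) : Eproj S w * Eproj S w = Eproj S w := by
  induction w with
  | nil => simp [Eproj]
  | cons i w ih =>
    calc star (S i) * Eproj S w * S i * (star (S i) * Eproj S w * S i)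
        = star (S i) * Eproj S w * (S i * star (S i) * Eproj S w) * S i := by noncomm_ring
      _ = star (S i) * (Eproj S w * Eproj S w) * (S i * star (S i) * S i) := by
        rw [hcomm]; noncomm_ring
      _ = star (S i) * Eproj S w * S i := by rw [ih, hS]

theorem Eproj_mul_eq_zero {N : ℕ} {B : Type*} [Ring B] [StarRing B] (S : Fin N → B)
    (hS : ∀ i j, i ≠ j → S i * star (S j) = 0)
    (hcomm : ∀ k w, S k * star (S k) * Eproj S w = Eproj S w * (S k * star (S k)))
    (v w : List (Fin N)) (hlen : w.length = v.length) (hne : w ≠ v) :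
    Eproj S v * Eproj S w = 0 := by
  induction v generalizing w with
  | nil => exact absurd (List.eq_nil_of_length_eq_zero hlen) hne
  | cons i v ih =>
    cases w with
    | nil => simp at hlen
    | cons j w =>
      have h : Eproj S (i :: v) * Eproj S (j :: w)
          = star (S i) * Eproj S v * (S i * star (S j)) * Eproj S w * S j := by
        simp only [Eproj]; noncomm_ring
      rw [h]
      by_cases hij : i = j
      · subst hij
        rw [mul_assoc (star (S i)), ← hcomm, mul_assoc (star (S i)), mul_assoc _ (Eproj S v),
          ih w (by simpa using hlen) (by simpa using hne)]
        simp
      · rw [hS i j hij]; simp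

theorem Eproj_append_eq_zero {N : ℕ} {B : Type*} [Ring B] [StarRing B] (S : Fin N → B)
    (v w : List (Fin N)) (h : Eproj S w = 0) : Eproj S (v ++ w) = 0 := by
  induction v with
  | nil => exact h
  | cons i v ih => simp [Eproj, ih]

/-- projection structure, from Proposition 3.7: under the
relations (1.1)–(1.4), each `E_μ` (`μ` admissible) is a self-adjoint idempotent,
distinct admissible words of the same length give orthogonal projections, and
`E_{μ₁⋯μ_l} = Σ_{h : A(μ_l,h)=1} E_{μ₁⋯μ_l h}`. -/
theorem stmt15 {N : ℕ} (hN : 2 ≤ N) (A : Fin N → Fin N → Bool)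
    (hrow : ∀ i, ∃ j, A i j = true) (hcol : ∀ j, ∃ i, A i j = true)
    {B : Type*} [CStarAlgebra B] (S T : Fin N → B)
    (hSpi : ∀ i, S i * star (S i) * S i = S i)
    (hTpi : ∀ i, T i * star (T i) * T i = T i)
    (h11 : ∑ j, (S j * star (S j) + T j * star (T j)) = 1)
    (h12 : ∑ j, star (S j) * S j = 1)
    (h13 : ∀ i, star (T i) * T i = ∑ j, if A i j then star (S j) * S j else 0)
    (h14 : ∀ (i : Fin N) (w : List (Fin N)), w ≠ [] →
      Eproj S (i :: w) =
        (∑ j, if A j i then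
          S j * star (S j) * Eproj S (i :: w) * (S j * star (S j)) else 0)
        + T i * Eproj S w * star (T i))
    (μ : List (Fin N)) (hμ : μ ≠ []) (hadm : MarkovAdm A μ) :
    (star (Eproj S μ) = Eproj S μ ∧ Eproj S μ * Eproj S μ = Eproj S μ) ∧
    (∀ ν : List (Fin N), MarkovAdm A ν → ν.length = μ.length → ν ≠ μ →
      Eproj S μ * Eproj S ν = 0) ∧
    (∀ last : Fin N, μ.getLast? = some last →
      Eproj S μ = ∑ h, if A last h then Eproj S (μ ++ [h]) else 0) := by
  have hSpi' : ∀ i, star (S i) * S i * star (S i) = star (S i) := fun i => by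
    simpa [mul_assoc] using congrArg star (hSpi i)
  have hQ : ∀ i j, i ≠ j → star (S i) * S i * (star (S j) * S j) = 0 := fun i j hij =>
    mul_eq_zero_of_sum_projections_eq_one (fun i => star (S i) * S i) (by simp)
      (fun i => by rw [← mul_assoc, hSpi']) h12 hij
  have hSS : ∀ i j, i ≠ j → S i * star (S j) = 0 := fun i j hij => by
    calc S i * star (S j)
        = (S i * star (S i) * S i) * (star (S j) * S j * star (S j)) := by rw [hSpi, hSpi']
      _ = S i * (star (S i) * S i * (star (S j) * S j)) * star (S j) := by noncomm_ring
      _ = 0 := by rw [hQ i j hij]; simp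
  let r : Fin N ⊕ Fin N → B :=
    Sum.elim (fun j => S j * star (S j)) (fun j => T j * star (T j))
  have hr : ∀ {a b}, a ≠ b → r a * r b = 0 :=
    mul_eq_zero_of_sum_projections_eq_one r (by rintro (i | i) <;> simp [r])
      (by rintro (i | i) <;> simp only [r, Sum.elim_inl, Sum.elim_inr] <;>
            rw [← mul_assoc] <;> simp only [hSpi, hTpi])
      (by rw [← h11, Fintype.sum_sum_type, Finset.sum_add_distrib]; rfl)
  have hPid : ∀ i, S i * star (S i) * (S i * star (S i)) = S i * star (S i) := fun i => by
    rw [← mul_assoc, hSpi]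
  have hP : ∀ i j, i ≠ j → S i * star (S i) * (S j * star (S j)) = 0 := fun i j hij =>
    hr (a := .inl i) (b := .inl j) (by simpa using hij)
  have hPT : ∀ i k, S k * star (S k) * T i = 0 := fun i k => by
    rw [← hTpi i, ← mul_assoc,
      show S k * star (S k) * (T i * star (T i)) = 0 from hr (a := .inl k) (b := .inr i) (by simp),
      zero_mul]
  have h14' : ∀ (i : Fin N) (w : List (Fin N)),
      Eproj S (i :: w) =
        (∑ j, if A j i then
          S j * star (S j) * Eproj S (i :: w) * (S j * star (S j)) else 0)
        + T i * Eproj S w * star (T i) := by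
    intro i w
    rcases eq_or_ne w [] with rfl | hw
    · have h := Finset.sum_congr rfl fun h (_ : h ∈ Finset.univ) => h14 i [h] (by simp)
      have hs := sum_Eproj_append S h12 [i]
      have hn := sum_Eproj_append S h12 []
      simp only [List.cons_append, List.nil_append] at hs hn
      rw [Finset.sum_add_distrib, ← Finset.sum_mul, ← Finset.mul_sum, hn, hs,
        Finset.sum_comm] at h
      refine h.trans ?_
      congr 1
      refine Finset.sum_congr rfl fun j _ => ?_
      split_ifs
      · rw [← Finset.sum_mul, ← Finset.mul_sum, hs]
      · simp
    · exact h14 i w hw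
  have hblock : ∀ k i w, S k * star (S k) * Eproj S (i :: w) =
      if A k i then S k * star (S k) * Eproj S (i :: w) * (S k * star (S k)) else 0 :=
    fun k i w => mul_eq_block (fun j => S j * star (S j)) (fun j => A j i) _ _ _ hPid hP (hPT i)
      (h14' i w) k
  have hcomm : ∀ k w, S k * star (S k) * Eproj S w = Eproj S w * (S k * star (S k)) := by
    rintro k (_ | ⟨i, w⟩)
    · simp [Eproj]
    · exact commute_of_mul_eq_block _ (by simp) (star_Eproj S _) (hblock k i w)
  refine ⟨⟨star_Eproj S μ, Eproj_mul_self S hSpi hcomm μ⟩,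
    fun ν _ hlen hne => Eproj_mul_eq_zero S hSS hcomm μ ν hlen hne, fun last hlast => ?_⟩
  conv_lhs => rw [← sum_Eproj_append S h12 μ]
  refine Finset.sum_congr rfl fun h _ => ?_
  split_ifs with hA
  · rfl
  · obtain ⟨v, rfl⟩ := List.getLast?_eq_some_iff.1 hlast
    rw [List.append_assoc]
    refine Eproj_append_eq_zero S v _ ?_
    have hz := hblock last h []
    rw [if_neg hA] at hz
    calc star (S last) * Eproj S [h] * S last
        = star (S last) * (S last * star (S last) * Eproj S [h]) * S last := by
          simp only [← mul_assoc, hSpi']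
      _ = 0 := by rw [hz]; simp
end

section
/- (Derivation in Proposition 5.1, Dyck shift case) Let B be a unital C*-algebra containing partial isometries S_1,…,S_N (S_i S_i* S_i = S_i) and isometries T_1,…,T_N (T_i* T_i = 1) such that Σ_{j=1}^N S_j* S_j = 1 and, for every word μ₁⋯μ_k over {1,…,N} with k ≥ 2, E_{μ₁⋯μ_k} = Σ_{j=1}^N S_j S_j* E_{μ₁⋯μ_k} S_j S_j* + T_{μ₁} E_{μ₂⋯μ_k} T_{μ₁}*, where E_{μ₁⋯μ_k} := S_{μ₁}*⋯S_{μ_k}* S_{μ_k}⋯S_{μ₁} and E_{μ₁} := S_{μ₁}* S_{μ₁}. Then Σ_{j=1}^N (S_j S_j* + T_j T_j*) = 1, and moreover S_i* S_i = Σ_{j=1}^N S_j S_j* S_i* S_i S_j S_j* + T_i T_i* for each i. -/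
open scoped BigOperators

/-- derivation in Proposition 5.1, Dyck shift case: if
`S_1,…,S_N` are partial isometries and `T_1,…,T_N` isometries with
`Σ_j S_j* S_j = 1` and `E_{μ₁⋯μ_k} = Σ_j S_j S_j* E_{μ₁⋯μ_k} S_j S_j*
+ T_{μ₁} E_{μ₂⋯μ_k} T_{μ₁}*` for all words of length `k ≥ 2`, then
`Σ_j (S_j S_j* + T_j T_j*) = 1` and
`S_i* S_i = Σ_j S_j S_j* S_i* S_i S_j S_j* + T_i T_i*`. -/
theorem stmt17 {N : ℕ} (hN : 2 ≤ N)
    {B : Type*} [CStarAlgebra B] (S T : Fin N → B)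
    (hSpi : ∀ i, S i * star (S i) * S i = S i)
    (hTiso : ∀ i, star (T i) * T i = 1)
    (h12 : ∑ j, star (S j) * S j = 1)
    (h14 : ∀ (i : Fin N) (w : List (Fin N)), w ≠ [] →
      Eproj S (i :: w) =
        (∑ j, S j * star (S j) * Eproj S (i :: w) * (S j * star (S j)))
        + T i * Eproj S w * star (T i)) :
    (∑ j, (S j * star (S j) + T j * star (T j))) = 1 ∧
    (∀ i : Fin N, star (S i) * S i =
      (∑ j, S j * star (S j) * (star (S i) * S i) * (S j * star (S j)))
      + T i * star (T i)) := by
  have h_second : ∀ i : Fin N, star (S i) * S i =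
      (∑ j, S j * star (S j) * (star (S i) * S i) * (S j * star (S j)))
      + T i * star (T i) := by
    intro i
    have hE : ∑ k, Eproj S [i, k] = star (S i) * S i := by
      simp only [Eproj, mul_one, ← Finset.sum_mul, ← Finset.mul_sum, h12]
    have hsum : ∑ k, Eproj S [i, k] = ∑ k, ((∑ j, S j * star (S j) * Eproj S [i, k]
        * (S j * star (S j))) + T i * Eproj S [k] * star (T i)) :=
      Finset.sum_congr rfl fun k _ => h14 i [k] (by simp)
    rw [Finset.sum_add_distrib, Finset.sum_comm] at hsum
    simp only [← Finset.sum_mul, ← Finset.mul_sum, hE] at hsum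
    simpa only [Eproj, mul_one, h12] using hsum
  refine ⟨?_, h_second⟩
  have hP : ∀ j, S j * star (S j) * (S j * star (S j)) = S j * star (S j) := fun j => by
    rw [← mul_assoc, hSpi]
  have hsum := Finset.sum_congr (s₁ := Finset.univ) rfl fun i _ => h_second i
  rw [h12, Finset.sum_add_distrib, Finset.sum_comm] at hsum
  simp only [← Finset.sum_mul, ← Finset.mul_sum, h12, mul_one, hP] at hsum
  rw [Finset.sum_add_distrib, ← hsum]
end
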